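/- arXiv:2506.00135 — 2 statements merged into one kernel-verified Lean document; each statement's English description precedes it below -/
import Mathlib

section
/- Let n be an integer with n > 10. Consider any value-labeled binary tree whose root has value n and whose depth is at most 1.05·log₂(n). Then the cost of the tree is at least (1/10)·n·log₂(n). -/
/-- A value-labeled binary tree: leaves carry value 1, and every internal node has
exactly two children whose values sum to the parent's value.  Since the values are
determined by the shape (the value of a node is the number of leaves in its subtree),
we represent such trees by their shape. -/
inductive VTree : Type
  | leaf : VTree
  | node : VTree → VTree → VTree

/-- The (positive integer) value of the root of a value-labeled binary tree. -/
def VTree.value : VTree → ℕ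
  | .leaf => 1
  | .node l r => l.value + r.value

/-- The depth of the tree: the maximum number of edges on a root-to-leaf path. -/
def VTree.depth : VTree → ℕ
  | .leaf => 0
  | .node l r => max l.depth r.depth + 1

/-- The cost of the tree: the sum over internal nodes of the minimum of the values
of the node's two children. -/
def VTree.cost : VTree → ℕ
  | .leaf => 0
  | .node l r => min l.value r.value + l.cost + r.cost

open Real in
/-- The Gibbs inequality for the weights `1/3` and `2/3`. -/
theorem mul_log_add_le_entropy {y z : ℝ} (hy : 0 < y) (hz : 0 < z) :
    (y + z) * log (y + z) ≤
      y * log 2 + y * log y + z * log z + (y + z) * log (3 / 2) := by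
  have h₁ := one_sub_inv_le_log_of_pos (x := 3 * y / (y + z)) (by positivity)
  have h₂ := one_sub_inv_le_log_of_pos (x := 3 * z / (2 * (y + z))) (by positivity)
  have e₁ : log (3 * y / (y + z)) = log 3 + log y - log (y + z) := by
    rw [log_div (by positivity) (by positivity), log_mul (by positivity) (by positivity)]
  have e₂ : log (3 * z / (2 * (y + z))) = log 3 + log z - (log 2 + log (y + z)) := by
    rw [log_div (by positivity) (by positivity), log_mul (by positivity) (by positivity),
      log_mul (by positivity) (by positivity)]
  have e₃ : log (3 / 2 : ℝ) = log 3 - log 2 := log_div (by norm_num) (by norm_num)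
  have k₁ := mul_le_mul_of_nonneg_left h₁ hy.le
  have k₂ := mul_le_mul_of_nonneg_left h₂ hz.le
  have f₁ : y * (1 - (3 * y / (y + z))⁻¹) = y - (y + z) / 3 := by field_simp
  have f₂ : z * (1 - (3 * z / (2 * (y + z)))⁻¹) = z - 2 * (y + z) / 3 := by field_simp
  rw [f₁, e₁] at k₁
  rw [f₂, e₂] at k₂
  rw [e₃]
  linarith

theorem VTree.value_pos (t : VTree) : 0 < t.value := by
  induction t with
  | leaf => simp [VTree.value]
  | node l r hl hr => simp only [VTree.value]; omega

open Real in
/-- Cost lower bound in terms of value and depth, in natural logarithms. -/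
theorem VTree.value_mul_log_le (t : VTree) :
    (t.value : ℝ) * log t.value ≤ t.cost * log 2 + t.value * t.depth * log (3 / 2) := by
  induction t with
  | leaf => simp [VTree.value, VTree.cost, VTree.depth]
  | node l r hl hr =>
    have pl : (0 : ℝ) < l.value := by exact_mod_cast l.value_pos
    have pr : (0 : ℝ) < r.value := by exact_mod_cast r.value_pos
    have hpos : 0 < log (3 / 2 : ℝ) := log_pos (by norm_num)
    have key : ((l.value : ℝ) + r.value) * log (l.value + r.value) ≤
        min (l.value : ℝ) r.value * log 2 + l.value * log l.value + r.value * log r.value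
          + (l.value + r.value) * log (3 / 2) := by
      rcases le_total (l.value : ℝ) r.value with h | h
      · rw [min_eq_left h]
        exact mul_log_add_le_entropy pl pr
      · rw [min_eq_right h]
        have := mul_log_add_le_entropy pr pl
        rw [add_comm (r.value : ℝ)] at this
        linarith
    have dl : (l.value : ℝ) * l.depth * log (3 / 2) ≤
        l.value * max (l.depth : ℝ) r.depth * log (3 / 2) := by
      gcongr
      exact le_max_left _ _
    have dr : (r.value : ℝ) * r.depth * log (3 / 2) ≤
        r.value * max (l.depth : ℝ) r.depth * log (3 / 2) := by
      gcongr
      exact le_max_right _ _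
    simp only [VTree.value, VTree.cost, VTree.depth]
    push_cast
    linarith

/-- For `n > 10`, any value-labeled binary tree with root value `n`
and depth at most `1.05 · log₂ n` has cost at least `(1/10) · n · log₂ n`. -/
theorem vtree_cost_lower_bound (n : ℕ) (hn : 10 < n) (t : VTree)
    (hval : t.value = n)
    (hdepth : (t.depth : ℝ) ≤ 1.05 * Real.logb 2 n) :
    (1 / 10 : ℝ) * n * Real.logb 2 n ≤ (t.cost : ℝ) := by
  have hlog2 : 0 < Real.log 2 := Real.log_pos (by norm_num)
  have hlogn : 0 ≤ Real.log n := Real.log_natCast_nonneg n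
  have hmain := t.value_mul_log_le
  rw [hval] at hmain
  have hratio : Real.log (3 / 2) ≤ 3 / 4 * Real.log 2 := by
    have h : Real.log ((3 / 2 : ℝ) ^ 4) ≤ Real.log ((2 : ℝ) ^ 3) :=
      Real.log_le_log (by norm_num) (by norm_num)
    rw [Real.log_pow, Real.log_pow] at h
    push_cast at h
    linarith
  have hd : (t.depth : ℝ) * Real.log 2 ≤ 1.05 * Real.log n := by
    rwa [Real.logb, ← mul_div_assoc, le_div_iff₀ hlog2] at hdepth
  have hdn : (n : ℝ) * t.depth * Real.log (3 / 2) ≤ 0.9 * (n * Real.log n) := by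
    calc (n : ℝ) * t.depth * Real.log (3 / 2)
        ≤ n * t.depth * (3 / 4 * Real.log 2) := by gcongr
      _ = 3 / 4 * n * (t.depth * Real.log 2) := by ring
      _ ≤ 3 / 4 * n * (1.05 * Real.log n) := by gcongr
      _ ≤ 0.9 * (n * Real.log n) := by
        have : 0 ≤ (n : ℝ) * Real.log n := by positivity
        linarith
  rw [Real.logb, ← mul_div_assoc, div_le_iff₀ hlog2]
  linarith
end

section
/- Let n ≥ 2 be an integer and consider any value-labeled binary tree whose root has value n and whose depth is at most D. Let h₂(t) = −t·log₂(t) − (1 − t)·log₂(1 − t) denote the base-2 binary entropy function. Then for every real number t with 0 < t < 1/2, the cost of the tree is at least n · t · (log₂(n) − D·h₂(t)) / (1 − h₂(t)). -/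
/-- The base-2 binary entropy function `h₂(t) = −t·log₂ t − (1−t)·log₂(1−t)`. -/
noncomputable def binEntropy2 (t : ℝ) : ℝ :=
  -t * Real.logb 2 t - (1 - t) * Real.logb 2 (1 - t)

open Real in
/-- The entropy chain rule for splitting a mass `a + b` into `a` and `b`. -/
theorem add_mul_log_add_eq {a b : ℝ} (ha : 0 < a) (hb : 0 < b) :
    (a + b) * log (a + b)
      = a * log a + b * log b + (a + b) * binEntropy (a / (a + b)) := by
  have hab : a + b ≠ 0 := by positivity
  have h1 : 1 - a / (a + b) = b / (a + b) := by field_simp; ring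
  rw [binEntropy_eq_negMulLog_add_negMulLog_one_sub, h1, negMulLog, negMulLog,
    log_div ha.ne' hab, log_div hb.ne' hab]
  field_simp
  ring

open Real in
/-- On `[0, ∞)`, binary entropy lies below the line through `(0, h(t))` and `(t, log 2)`. -/
theorem mul_binEntropy_le {t p : ℝ} (ht0 : 0 < t) (ht1 : t < 1 / 2) (hp0 : 0 ≤ p) :
    t * binEntropy p ≤ t * binEntropy t + (log 2 - binEntropy t) * p := by
  have hL : 0 ≤ log 2 - binEntropy t := sub_nonneg.2 binEntropy_le_log_two
  rcases le_total p t with h | h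
  · have hmono : binEntropy p ≤ binEntropy t :=
      binEntropy_strictMonoOn.monotoneOn ⟨hp0, by norm_num at *; linarith⟩
        ⟨ht0.le, by norm_num at *; linarith⟩ h
    have := mul_le_mul_of_nonneg_left hmono ht0.le
    have := mul_nonneg hL hp0
    linarith
  · have := mul_le_mul_of_nonneg_left (binEntropy_le_log_two (p := p)) ht0.le
    have := mul_le_mul_of_nonneg_left h hL
    linarith

open Real in
/-- The entropy created by one split is controlled by the smaller part. -/
theorem mul_add_mul_log_add_le {t a b : ℝ} (ht0 : 0 < t) (ht1 : t < 1 / 2)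
    (ha : 0 < a) (hb : 0 < b) :
    t * ((a + b) * log (a + b)) ≤ t * (a * log a) + t * (b * log b)
      + t * binEntropy t * (a + b) + (log 2 - binEntropy t) * min a b := by
  wlog hab : a ≤ b generalizing a b
  · have := this hb ha (le_of_not_ge hab)
    rw [add_comm b a, min_comm b a] at this
    linarith
  have hx : 0 < a + b := by positivity
  have h := mul_le_mul_of_nonneg_left
    (mul_binEntropy_le ht0 ht1 (p := a / (a + b)) (by positivity)) hx.le
  have hdiv : (a + b) * (a / (a + b)) = a := by field_simp
  rw [min_eq_left hab, add_mul_log_add_eq ha hb]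
  linear_combination h + (log 2 - binEntropy t) * hdiv

theorem VTree.value_pos_s1 (tr : VTree) : 0 < tr.value := by
  induction tr with
  | leaf => simp [VTree.value]
  | node l r hl hr => simp only [VTree.value]; omega

open Real in
/-- The entropy bound in natural logarithms, with the depth of the tree itself. -/
theorem VTree.mul_value_mul_log_value_le (tr : VTree) {t : ℝ} (ht0 : 0 < t) (ht1 : t < 1 / 2) :
    t * (tr.value * log tr.value)
      ≤ t * binEntropy t * (tr.value * tr.depth) + (log 2 - binEntropy t) * tr.cost := by
  induction tr with
  | leaf => simp [VTree.value, VTree.depth, VTree.cost]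
  | node l r hl hr =>
    have hl0 : (0 : ℝ) < l.value := by exact_mod_cast l.value_pos_s1
    have hr0 : (0 : ℝ) < r.value := by exact_mod_cast r.value_pos_s1
    have hsplit := mul_add_mul_log_add_le ht0 ht1 hl0 hr0
    have hH : 0 ≤ t * binEntropy t :=
      mul_nonneg ht0.le (binEntropy_nonneg ht0.le (by linarith))
    have hdl := mul_le_mul_of_nonneg_left
      (mul_le_mul_of_nonneg_left (le_max_left (l.depth : ℝ) r.depth) hl0.le) hH
    have hdr := mul_le_mul_of_nonneg_left
      (mul_le_mul_of_nonneg_left (le_max_right (l.depth : ℝ) r.depth) hr0.le) hH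
    simp only [VTree.value, VTree.depth, VTree.cost]
    push_cast
    linarith

theorem binEntropy2_eq_div (t : ℝ) : binEntropy2 t = Real.binEntropy t / Real.log 2 := by
  rw [binEntropy2, Real.binEntropy_eq_negMulLog_add_negMulLog_one_sub, Real.negMulLog,
    Real.negMulLog, Real.logb, Real.logb]
  ring

/-- For `n ≥ 2`, any value-labeled binary tree with root value `n`
and depth at most `D` has cost at least `n · t · (log₂ n − D·h₂(t)) / (1 − h₂(t))`
for every real `t` with `0 < t < 1/2`. -/
theorem vtree_cost_entropy_lower_bound (n : ℕ) (hn : 2 ≤ n) (tr : VTree)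
    (hval : tr.value = n) (D : ℝ) (hdepth : (tr.depth : ℝ) ≤ D)
    (t : ℝ) (ht0 : 0 < t) (ht1 : t < 1 / 2) :
    (n : ℝ) * t * (Real.logb 2 n - D * binEntropy2 t) / (1 - binEntropy2 t)
      ≤ (tr.cost : ℝ) := by
  subst hval
  have hL : 0 < Real.log 2 := Real.log_pos one_lt_two
  have hlt : Real.binEntropy t < Real.log 2 :=
    Real.binEntropy_lt_log_two.2 (by norm_num at *; linarith)
  have hH : 0 ≤ t * Real.binEntropy t :=
    mul_nonneg ht0.le (Real.binEntropy_nonneg ht0.le (by linarith))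
  have hmain := tr.mul_value_mul_log_value_le ht0 ht1
  have hD := mul_le_mul_of_nonneg_left
    (mul_le_mul_of_nonneg_left hdepth (Nat.cast_nonneg (α := ℝ) tr.value)) hH
  have hgap : 0 < 1 - binEntropy2 t := by
    rw [binEntropy2_eq_div, sub_pos, div_lt_one hL]
    exact hlt
  rw [div_le_iff₀ hgap, ← mul_le_mul_iff_left₀ hL, binEntropy2_eq_div, Real.logb]
  have hleft : (tr.value : ℝ) * t * (Real.log tr.value / Real.log 2
      - D * (Real.binEntropy t / Real.log 2)) * Real.log 2
      = tr.value * t * (Real.log tr.value - D * Real.binEntropy t) := by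
    field_simp
  have hright : (tr.cost : ℝ) * (1 - Real.binEntropy t / Real.log 2) * Real.log 2
      = tr.cost * (Real.log 2 - Real.binEntropy t) := by
    field_simp
  rw [hleft, hright]
  linarith
end
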